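/- Suppose there exists a (c₁, t-1) NLP-packing {P_{1,0},…,P_{1,t-2}} in an abelian group G₁ of order t²c₁², and a (c₂, t) LP-packing {P_{2,0},…,P_{2,t-1}} in an abelian group G₂ of order t²c₂² relative to a subgroup U₂ of order tc₂. Set P_{1,t-1} = G₁ ∖ ⋃_{i=0}^{t-2} P_{1,i}, and define K_ℓ = P_{1,ℓ}·U₂ ∪ ⋃_{i=0}^{t-1} P_{1,i}·P_{2,i+ℓ} for ℓ = 0,…,t-2 (indices mod t; A·B = {(a,b): a∈A, b∈B}). Then {K₀,…,K_{t-2}} is a (tc₁c₂, t-1) NLP-packing in G₁ × G₂. -/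

import Mathlib

open Finset BigOperators

variable {G : Type*}

/-- Number of ordered pairs `(x,y)` with `x,y ∈ D`, `x ≠ y`, `x * y⁻¹ = g`. -/
noncomputable def diffCount [Group G] (D : Set G) (g : G) : ℕ :=
  Nat.card {p : G × G // p.1 ∈ D ∧ p.2 ∈ D ∧ p.1 ≠ p.2 ∧ p.1 * p.2⁻¹ = g}

/-- `D` is a `(v,k,λ,μ)` partial difference set in `G`. -/
def IsPDS [Group G] (D : Set G) (v k : ℕ) (l m : ℤ) : Prop :=
  Nat.card G = v ∧ Nat.card D = k ∧
    ∀ g : G, g ≠ 1 →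
      (g ∈ D → (diffCount D g : ℤ) = l) ∧ (g ∉ D → (diffCount D g : ℤ) = m)

/-- A regular PDS: a PDS avoiding the identity and closed under inversion. -/
def IsRegularPDS [Group G] (D : Set G) (v k : ℕ) (l m : ℤ) : Prop :=
  IsPDS D v k l m ∧ (1 : G) ∉ D ∧ D⁻¹ = D

/-- A regular `(n,r)` Latin square type PDS. -/
def IsLatinPDS [Group G] (D : Set G) (n r : ℕ) : Prop :=
  IsRegularPDS D (n ^ 2) (r * (n - 1)) ((n : ℤ) + (r : ℤ) ^ 2 - 3 * r) ((r : ℤ) ^ 2 - r)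

/-- A regular `(n,r)` negative Latin square type PDS. -/
def IsNegLatinPDS [Group G] (D : Set G) (n r : ℕ) : Prop :=
  IsRegularPDS D (n ^ 2) (r * (n + 1)) (-(n : ℤ) + (r : ℤ) ^ 2 + 3 * r) ((r : ℤ) ^ 2 + r)

/-- Character sum `χ(D) = ∑_{d ∈ D} χ(d)`. -/
noncomputable def charSum [Group G] (χ : G →* ℂˣ) (D : Set G) : ℂ :=
  ∑ᶠ d ∈ D, (χ d : ℂ)

/-- The multiset of character sums `{χ(P 0), …, χ(P (t-1))}`. -/
noncomputable def charMultiset [Group G] {t : ℕ} (χ : G →* ℂˣ) (P : Fin t → Set G) :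
    Multiset ℂ :=
  (Finset.univ.val : Multiset (Fin t)).map fun i => charSum χ (P i)

/-- `χ` is principal on the subgroup `U`. -/
def IsPrincipalOn [Group G] (χ : G →* ℂˣ) (U : Subgroup G) : Prop :=
  ∀ u ∈ U, χ u = 1

/-- A `(c,t)` LP-packing in `G` relative to `U`. -/
def IsLPPacking [CommGroup G] (c t : ℕ) (P : Fin t → Set G) (U : Subgroup G) : Prop :=
  Nat.card G = t ^ 2 * c ^ 2 ∧ Nat.card U = t * c ∧
    (∀ i, IsLatinPDS (P i) (t * c) c) ∧
    (∀ i j, i ≠ j → Disjoint (P i) (P j)) ∧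
    (⋃ i, P i) = Set.univ \ (U : Set G)

/-- A `(c,t-1)` NLP-packing in `G`. -/
def IsNLPPacking [CommGroup G] (c t : ℕ) (P : Fin (t - 1) → Set G) : Prop :=
  Nat.card G = t ^ 2 * c ^ 2 ∧
    (∀ i, IsNegLatinPDS (P i) (t * c) c) ∧
    IsNegLatinPDS (Set.univ \ ({1} ∪ ⋃ i, P i)) (t * c) (c - 1)

/-- A `(c,t)` LP-partition in `G − V` relative to `H`. -/
def IsLPPartition [CommGroup G] (c t : ℕ) (R : Fin t → Set G) (V H : Subgroup G) : Prop :=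
  Nat.card G = t ^ 2 * c ^ 2 ∧ Nat.card V = t * c ^ 2 ∧ H ≤ V ∧
    (∀ i, Nat.card (R i) = (t - 1) * c ^ 2) ∧
    (∀ i j, i ≠ j → Disjoint (R i) (R j)) ∧
    (⋃ i, R i) = Set.univ \ (V : Set G) ∧
    ∀ χ : G →* ℂˣ, χ ≠ 1 →
      (IsPrincipalOn χ V → charMultiset χ R = Multiset.replicate t (-(c : ℂ) ^ 2)) ∧
      (¬ IsPrincipalOn χ V → IsPrincipalOn χ H →
        charMultiset χ R = Multiset.replicate t 0) ∧
      (¬ IsPrincipalOn χ H →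
        charMultiset χ R = ((t : ℂ) - 1) * (c : ℂ) ::ₘ Multiset.replicate (t - 1) (-(c : ℂ)))

/-- The number of pairs in `D × D` with quotient `g`, the diagonal included. -/
noncomputable def quotientCount {H : Type*} [CommGroup H] (D : Set H) (g : H) : ℕ :=
  Nat.card {p : H × H // p.1 ∈ D ∧ p.2 ∈ D ∧ p.1 * p.2⁻¹ = g}

theorem quotientCount_eq_diffCount {H : Type*} [CommGroup H] (D : Set H) {g : H} (hg : g ≠ 1) :
    quotientCount D g = diffCount D g := by
  refine Nat.card_congr (Equiv.subtypeEquivRight fun p => ?_)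
  constructor
  · rintro ⟨h1, h2, h3⟩
    refine ⟨h1, h2, fun h => hg ?_, h3⟩
    rw [← h3, h, mul_inv_cancel]
  · rintro ⟨h1, h2, -, h3⟩
    exact ⟨h1, h2, h3⟩

theorem quotientCount_one {H : Type*} [CommGroup H] (D : Set H) : quotientCount D 1 = Nat.card D := by
  refine Nat.card_congr ⟨fun p => ⟨p.1.1, p.2.1⟩, fun x => ⟨(x.1, x.1), x.2, x.2, by simp⟩, ?_, ?_⟩
  · rintro ⟨⟨x, y⟩, h1, h2, h3⟩
    have : x = y := by simpa [mul_inv_eq_one] using h3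
    simp [this]
  · intro x
    rfl

theorem sum_indicator_one_eq_card {X : Type*} [Fintype X] (D : Set X) :
    ∑ x, D.indicator (1 : X → ℂ) x = Nat.card D := by
  classical
  simp [Set.indicator_apply, Nat.card_eq_fintype_card, Fintype.card_subtype]

section CharacterSums

variable {H : Type*} [CommGroup H] [Fintype H]

/-- The sum of a complex character over a subset of a finite abelian group. -/
noncomputable def setCharSum (χ : H →* ℂ) (D : Set H) : ℂ :=
  ∑ x, D.indicator χ x

theorem setCharSum_one (D : Set H) : setCharSum (1 : H →* ℂ) D = Nat.card D :=
  sum_indicator_one_eq_card D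

/-- The additive character attached to a multiplicative one. -/
noncomputable def addCharOfHom (χ : H →* ℂ) : AddChar (Additive H) ℂ where
  toFun x := χ x.toMul
  map_zero_eq_one' := by simp
  map_add_eq_mul' x y := by simp

/-- The multiplicative character attached to an additive one. -/
noncomputable def homOfAddChar (ψ : AddChar (Additive H) ℂ) : H →* ℂ where
  toFun x := ψ (Additive.ofMul x)
  map_one' := by simp
  map_mul' x y := by simp [AddChar.map_add_eq_mul]

theorem sum_hom_eq_ite [Decidable ((χ : H →* ℂ) = 1)] :
    ∑ x, χ x = if χ = 1 then (Fintype.card H : ℂ) else 0 := by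
  classical
  split_ifs with h
  · simp [h]
  · have h' : addCharOfHom χ ≠ 0 := by
      intro h0
      apply h
      ext x
      simpa [addCharOfHom] using DFunLike.congr_fun h0 (Additive.ofMul x)
    have := AddChar.sum_eq_zero_iff_ne_zero.2 h'
    rw [← this]
    exact Fintype.sum_equiv Additive.ofMul _ _ fun x => rfl

theorem eq_zero_of_forall_sum_mul_hom_eq_zero (f : H → ℂ)
    (hf : ∀ χ : H →* ℂ, ∑ x, f x * χ x = 0) : f = 0 := by
  classical
  funext h
  have key : ∀ x : H, ∑ ψ : AddChar (Additive H) ℂ, ψ (Additive.ofMul (x * h⁻¹)) =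
      if x = h then (Fintype.card H : ℂ) else 0 := by
    intro x
    rw [AddChar.sum_apply_eq_ite]
    have : Additive.ofMul (x * h⁻¹) = 0 ↔ x = h := by rw [ofMul_eq_zero, mul_inv_eq_one]
    simp only [this, Fintype.card_additive]
  have h1 : ∑ x, f x * ∑ ψ : AddChar (Additive H) ℂ, ψ (Additive.ofMul (x * h⁻¹)) = 0 := by
    simp_rw [Finset.mul_sum]
    rw [Finset.sum_comm]
    refine Finset.sum_eq_zero fun ψ _ => ?_
    have := hf (homOfAddChar ψ)
    calc ∑ x, f x * ψ (Additive.ofMul (x * h⁻¹))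
        = (∑ x, f x * homOfAddChar ψ x) * ψ (Additive.ofMul h⁻¹) := by
          rw [Finset.sum_mul]
          refine Finset.sum_congr rfl fun x _ => ?_
          rw [ofMul_mul, AddChar.map_add_eq_mul, ← mul_assoc]
          rfl
      _ = 0 := by rw [this, zero_mul]
  simp_rw [key] at h1
  simpa using h1

theorem setCharSum_inv {D : Set H} (hD : D⁻¹ = D) (χ : H →* ℂ) :
    ∑ x, D.indicator (fun y => χ y⁻¹) x = setCharSum χ D := by
  refine Fintype.sum_equiv (Equiv.inv H) _ _ fun x => ?_
  classical
  have : x⁻¹ ∈ D ↔ x ∈ D := by rw [← Set.mem_inv, hD]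
  simp [Set.indicator_apply, this]

theorem sum_quotientCount_mul {D : Set H} (hD : D⁻¹ = D) (χ : H →* ℂ) :
    ∑ g, (quotientCount D g : ℂ) * χ g = setCharSum χ D ^ 2 := by
  classical
  have h1 : ∀ g, (quotientCount D g : ℂ) =
      ∑ p : H × H, if p.1 ∈ D ∧ p.2 ∈ D ∧ p.1 * p.2⁻¹ = g then (1 : ℂ) else 0 := by
    intro g
    simp [quotientCount, Nat.card_eq_fintype_card, Fintype.card_subtype]
  simp_rw [h1, Finset.sum_mul]
  rw [Finset.sum_comm, sq]
  nth_rewrite 2 [← setCharSum_inv hD χ]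
  rw [setCharSum, Finset.sum_mul_sum,
    ← Fintype.sum_prod_type' fun x y => D.indicator χ x * D.indicator (fun y => χ y⁻¹) y]
  refine Finset.sum_congr rfl fun p _ => ?_
  by_cases hx : p.1 ∈ D <;> by_cases hy : p.2 ∈ D <;> simp [hx, hy]

/-- A symmetric set avoiding the identity is a partial difference set exactly when all its
character sums satisfy the corresponding quadratic equation. -/
theorem forall_diffCount_iff_forall_setCharSum {D : Set H} {k : ℕ} {l m : ℤ}
    (hk : Nat.card D = k) (h1 : (1 : H) ∉ D) (hD : D⁻¹ = D) :
    (∀ g : H, g ≠ 1 →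
      (g ∈ D → (diffCount D g : ℤ) = l) ∧ (g ∉ D → (diffCount D g : ℤ) = m)) ↔
    ∀ χ : H →* ℂ, setCharSum χ D ^ 2 =
      ((l : ℂ) - m) * setCharSum χ D + (m * ∑ x, χ x) + (k - m) := by
  classical
  set f : H → ℂ := fun g => (quotientCount D g : ℂ) -
    (((l : ℂ) - m) * D.indicator 1 g + m + if g = 1 then (k - m : ℂ) else 0) with hf
  have hsum : ∀ χ : H →* ℂ, ∑ g, f g * χ g = setCharSum χ D ^ 2 -
      (((l : ℂ) - m) * setCharSum χ D + (m * ∑ x, χ x) + (k - m)) := by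
    intro χ
    simp only [hf, sub_mul, add_mul, Finset.sum_sub_distrib, Finset.sum_add_distrib,
      sum_quotientCount_mul hD, ← Finset.mul_sum, mul_assoc]
    have e1 : ∑ i, D.indicator (1 : H → ℂ) i * χ i = setCharSum χ D := by
      refine Finset.sum_congr rfl fun x _ => ?_
      by_cases hx : x ∈ D <;> simp [hx]
    have e2 : ∑ i, (if i = 1 then (k - m : ℂ) else 0) * χ i = k - m := by simp
    rw [e1, e2]
  have hzero : (∀ g : H, g ≠ 1 →
      (g ∈ D → (diffCount D g : ℤ) = l) ∧ (g ∉ D → (diffCount D g : ℤ) = m)) ↔ f = 0 := by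
    rw [funext_iff]
    refine forall_congr' fun g => ?_
    by_cases hg : g = 1
    · subst hg
      simp only [hf, quotientCount_one, hk]
      simp [h1]
    · by_cases hgD : g ∈ D
      · simp [hf, hg, hgD, quotientCount_eq_diffCount D hg, sub_eq_zero]
        norm_cast
      · simp [hf, hg, hgD, quotientCount_eq_diffCount D hg, sub_eq_zero]
        norm_cast
  rw [hzero]
  constructor
  · intro h χ
    have := hsum χ
    simp only [h, Pi.zero_apply, zero_mul, Finset.sum_const_zero] at this
    exact sub_eq_zero.1 this.symm
  · intro h
    refine eq_zero_of_forall_sum_mul_hom_eq_zero f fun χ => ?_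
    rw [hsum, h, sub_self]

theorem IsNegLatinPDS.setCharSum_eq {D : Set H} {n r : ℕ} (h : IsNegLatinPDS D n r)
    {χ : H →* ℂ} (hχ : χ ≠ 1) : setCharSum χ D = r ∨ setCharSum χ D = r - n := by
  classical
  obtain ⟨⟨hv, hk, hd⟩, h1, hD⟩ := h
  have := (forall_diffCount_iff_forall_setCharSum hk h1 hD).1 hd χ
  rw [sum_hom_eq_ite, if_neg hχ] at this
  push_cast at this
  have h0 : (setCharSum χ D - r) * (setCharSum χ D - (r - n)) = 0 := by linear_combination this
  rcases mul_eq_zero.1 h0 with h0 | h0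
  · exact Or.inl (sub_eq_zero.1 h0)
  · exact Or.inr (sub_eq_zero.1 h0)

theorem IsLatinPDS.setCharSum_eq {D : Set H} {n r : ℕ} (hn : 0 < n) (h : IsLatinPDS D n r)
    {χ : H →* ℂ} (hχ : χ ≠ 1) : setCharSum χ D = -r ∨ setCharSum χ D = -r + n := by
  classical
  obtain ⟨⟨hv, hk, hd⟩, h1, hD⟩ := h
  have := (forall_diffCount_iff_forall_setCharSum hk h1 hD).1 hd χ
  rw [sum_hom_eq_ite, if_neg hχ] at this
  push_cast [Nat.cast_sub (show 1 ≤ n from hn)] at this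
  have h0 : (setCharSum χ D - -r) * (setCharSum χ D - (-r + n)) = 0 := by
    linear_combination this
  rcases mul_eq_zero.1 h0 with h0 | h0
  · exact Or.inl (sub_eq_zero.1 h0)
  · exact Or.inr (sub_eq_zero.1 h0)

theorem isNegLatinPDS_of_setCharSum {D : Set H} {n r : ℕ} (hv : Nat.card H = n ^ 2)
    (h1 : (1 : H) ∉ D) (hD : D⁻¹ = D) (htriv : setCharSum 1 D = r * (n + 1))
    (h : ∀ χ : H →* ℂ, χ ≠ 1 → setCharSum χ D = r ∨ setCharSum χ D = r - n) :
    IsNegLatinPDS D n r := by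
  classical
  have hk : Nat.card D = r * (n + 1) := by
    rw [setCharSum_one] at htriv
    exact_mod_cast htriv
  refine ⟨⟨hv, hk, (forall_diffCount_iff_forall_setCharSum hk h1 hD).2 fun χ => ?_⟩, h1, hD⟩
  rw [sum_hom_eq_ite]
  push_cast
  by_cases hχ : χ = 1
  · subst hχ
    rw [if_pos rfl, htriv, ← Nat.card_eq_fintype_card, hv]
    push_cast
    ring
  · rw [if_neg hχ]
    rcases h χ hχ with h | h <;> rw [h] <;> ring

theorem setCharSum_subgroup (χ : H →* ℂ) (U : Subgroup H) :
    setCharSum χ (U : Set H) = 0 ∨ setCharSum χ (U : Set H) = Nat.card U := by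
  classical
  have h : setCharSum χ (U : Set H) = ∑ x : U, (χ.comp U.subtype) x := by
    simp only [setCharSum, Set.indicator_apply, MonoidHom.comp_apply, Subgroup.subtype_apply]
    rw [← Finset.sum_filter]
    exact Finset.sum_subtype _ (by simp) _
  rw [h, sum_hom_eq_ite, Nat.card_eq_fintype_card]
  split_ifs <;> simp

theorem sum_setCharSum_fiber {ι : Type*} [Fintype ι] (α : H → ι) (χ : H →* ℂ) :
    ∑ i, setCharSum χ {x | α x = i} = ∑ x, χ x := by
  classical
  simp only [setCharSum]
  rw [Finset.sum_comm]
  refine Finset.sum_congr rfl fun x _ => ?_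
  simp [Set.indicator_apply]

end CharacterSums

/-- If numbers taken from `{u, u + d}` have the sum expected when exactly one of them is `u + d`,
then exactly one of them is. -/
theorem exists_forall_eq_add_ite {ι : Type*} [Fintype ι] [DecidableEq ι] {z : ι → ℂ} {u d : ℂ}
    (hd : d ≠ 0) (hz : ∀ i, z i = u ∨ z i = u + d)
    (hsum : ∑ i, z i = Fintype.card ι * u + d) :
    ∃ j, ∀ i, z i = u + if i = j then d else 0 := by
  classical
  have h1 : ∀ i, z i = u + if z i = u + d then d else 0 := by
    intro i
    by_cases h : z i = u + d
    · rw [if_pos h, h]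
    · rw [if_neg h, add_zero]
      exact (hz i).resolve_right h
  have h2 : ((#{i | z i = u + d} : ℕ) : ℂ) * d = 1 * d := by
    rw [Finset.sum_congr rfl fun i _ => h1 i, Finset.sum_add_distrib, ← Finset.sum_filter] at hsum
    simpa using hsum
  have h3 : #{i | z i = u + d} = 1 := by exact_mod_cast mul_right_cancel₀ hd h2
  obtain ⟨j, hj⟩ := Finset.card_eq_one.1 h3
  refine ⟨j, fun i => ?_⟩
  have : z i = u + d ↔ i = j := by simpa using Finset.ext_iff.1 hj i
  rw [h1 i]
  simp only [this]

/-- A cover of a finite type whose sizes add up to at most the size of the type is a partition. -/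
theorem exists_index_of_sum_card_le {X ι : Type*} [Finite X] [Fintype ι] {A : ι → Set X}
    (hcover : ∀ x, ∃ i, x ∈ A i) (hcard : ∑ i, Nat.card (A i) ≤ Nat.card X) :
    ∃ α : X → ι, ∀ x i, x ∈ A i ↔ α x = i := by
  classical
  cases nonempty_fintype X
  choose α hα using hcover
  refine ⟨α, fun x i => ⟨fun hx => ?_, fun h => h ▸ hα x⟩⟩
  let φ : X → Σ i, A i := fun x => ⟨α x, x, hα x⟩
  have hinj : Function.Injective φ := fun x y h => by
    have := congrArg (fun s : Σ i, A i => (s.2 : X)) h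
    exact this
  have hsurj : Function.Surjective φ := by
    refine ((Fintype.bijective_iff_injective_and_card φ).2 ⟨hinj, ?_⟩).2
    refine le_antisymm (Fintype.card_le_of_injective φ hinj) ?_
    rw [Fintype.card_sigma]
    simpa [Nat.card_eq_fintype_card] using hcard
  obtain ⟨y, hy⟩ := hsurj ⟨i, x, hx⟩
  have e1 : α y = i := congrArg Sigma.fst hy
  have e2 : y = x := congrArg (fun s : Σ i, A i => (s.2 : X)) hy
  rw [← e2, e1]

section Packings

variable {H : Type*} [CommGroup H] [Fintype H]

theorem setCharSum_insert_one {D : Set H} (h : (1 : H) ∉ D) (χ : H →* ℂ) :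
    setCharSum χ (insert 1 D) = 1 + setCharSum χ D := by
  classical
  have : ∀ x, (insert 1 D : Set H).indicator χ x = (if x = 1 then 1 else 0) + D.indicator χ x := by
    intro x
    by_cases hx : x = 1
    · subst hx
      simp [h]
    · by_cases hD : x ∈ D <;> simp [hx, hD]
  simp [setCharSum, this, Finset.sum_add_distrib]

theorem sum_comp_mul_eq_sum_setCharSum {ι : Type*} [Fintype ι] (α : H → ι) (g : ι → ℂ)
    (χ : H →* ℂ) : ∑ x, g (α x) * χ x = ∑ i, g i * setCharSum χ {x | α x = i} := by
  classical
  simp only [setCharSum, Finset.mul_sum]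
  rw [Finset.sum_comm]
  refine Finset.sum_congr rfl fun x _ => ?_
  simp [Set.indicator_apply]

/-- An NLP-packing is given by the fibres of a function to `Fin t`, the last fibre containing the
identity; at every character exactly one fibre has an exceptional character sum. -/
theorem IsNLPPacking.exists_index {c t : ℕ} (hc : 0 < c) {P : Fin (t - 1) → Set H}
    (h : IsNLPPacking c t P) {last : Fin t} (hlast : (last : ℕ) = t - 1) :
    ∃ (α : H → Fin t) (e : (H →* ℂ) → Fin t),
      (∀ i : Fin t, (if h : (i : ℕ) < t - 1 then P ⟨(i : ℕ), h⟩ else Set.univ \ ⋃ j, P j) =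
        {x | α x = i}) ∧
      α 1 = last ∧ (∀ x, α x⁻¹ = α x) ∧ e 1 = last ∧
      ∀ (χ : H →* ℂ) (i : Fin t), setCharSum χ {x | α x = i} =
        c - (if i = e χ then (t * c : ℂ) else 0) +
          open Classical in if χ = 1 then (t * c ^ 2 : ℂ) else 0 := by
  classical
  obtain ⟨hcard, hP, hD⟩ := h
  obtain ⟨s, rfl⟩ : ∃ s, t = s + 1 := ⟨t - 1, by have := last.2; omega⟩
  obtain rfl : last = Fin.last s := Fin.ext (by simpa using hlast)
  set D : Set H := Set.univ \ ({1} ∪ ⋃ i, P i) with hDdef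
  set A : Fin (s + 1) → Set H := fun i =>
    if h : (i : ℕ) < s + 1 - 1 then P ⟨(i : ℕ), h⟩ else Set.univ \ ⋃ j, P j with hA
  have hAc : ∀ i : Fin s, A i.castSucc = P i := fun i => by simp [hA]
  have h1P : ∀ i, (1 : H) ∉ P i := fun i => (hP i).2.1
  have hAl : A (Fin.last s) = insert 1 D := by
    ext x
    by_cases hx : x = 1
    · subst hx
      simp [hA, h1P]
    · simp [hA, hDdef, hx]
  have hcP : ∀ i : Fin s, Nat.card (A i.castSucc) = c * ((s + 1) * c + 1) := fun i => by
    rw [hAc]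
    exact (hP i).1.2.1
  have hcl : Nat.card (A (Fin.last s)) = (c - 1) * ((s + 1) * c + 1) + 1 := by
    rw [hAl, Nat.card_coe_set_eq, Set.ncard_insert_of_notMem hD.2.1, ← Nat.card_coe_set_eq,
      hD.1.2.1]
  obtain ⟨d, rfl⟩ : ∃ d, c = d + 1 := ⟨c - 1, by omega⟩
  obtain ⟨α, hα⟩ := exists_index_of_sum_card_le (A := A) (fun x => by
    by_cases hx : ∃ i, x ∈ P i
    · obtain ⟨i, hi⟩ := hx
      exact ⟨Fin.castSucc i, by rwa [hAc]⟩
    · exact ⟨Fin.last s, by simpa [hA] using hx⟩) (by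
    rw [Fin.sum_univ_castSucc, hcl, Finset.sum_congr rfl fun i _ => hcP i, hcard]
    simp only [sum_const, card_univ, Fintype.card_fin, smul_eq_mul, Nat.add_sub_cancel]
    apply le_of_eq
    ring)
  have hfib : ∀ i, A i = {x | α x = i} := fun i => Set.ext fun x => hα x i
  have hα1 : α 1 = Fin.last s := (hα 1 _).1 (by rw [hAl]; exact Set.mem_insert _ _)
  have hinv : ∀ x, α x⁻¹ = α x := by
    have hAinv : ∀ i, (A i)⁻¹ = A i := by
      intro i
      induction i using Fin.lastCases with
      | last =>
        have hx : ∀ x, x⁻¹ ∈ D ↔ x ∈ D := fun x => by rw [← Set.mem_inv, hD.2.2]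
        rw [hAl]
        ext x
        simp [hx]
      | cast i => rw [hAc, (hP i).2.2]
    intro x
    rw [← hα, ← Set.mem_inv, hAinv, hα]
  have hval : ∀ χ : H →* ℂ, χ ≠ 1 → ∃ j, ∀ i, setCharSum χ {x | α x = i} =
      ((d + 1 : ℕ) : ℂ) + if i = j then -(((s + 1 : ℕ) : ℂ) * ((d + 1 : ℕ) : ℂ)) else 0 := by
    intro χ hχ
    refine exists_forall_eq_add_ite ?_ ?_ ?_
    · rw [neg_ne_zero]
      exact_mod_cast Nat.mul_ne_zero s.succ_ne_zero d.succ_ne_zero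
    · intro i
      rw [← hfib]
      induction i using Fin.lastCases with
      | last =>
        rw [hAl, setCharSum_insert_one hD.2.1]
        rcases hD.setCharSum_eq hχ with h | h
        · left
          rw [h]
          push_cast [Nat.add_sub_cancel]
          ring
        · right
          rw [h]
          push_cast [Nat.add_sub_cancel]
          ring
      | cast i =>
        rw [hAc]
        rcases (hP i).setCharSum_eq hχ with h | h
        · exact Or.inl h
        · right
          rw [h]
          push_cast
          ring
    · rw [sum_setCharSum_fiber, sum_hom_eq_ite, if_neg hχ, Fintype.card_fin]
      ring
  choose! e he using hval
  refine ⟨α, fun χ => if χ = 1 then Fin.last s else e χ, hfib, hα1, hinv, by simp,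
    fun χ i => ?_⟩
  by_cases hχ : χ = 1
  · subst hχ
    simp only [if_true]
    rw [setCharSum_one, ← hfib]
    induction i using Fin.lastCases with
    | last =>
      rw [hcl]
      push_cast [Nat.add_sub_cancel]
      simp
      ring
    | cast i =>
      rw [hcP]
      push_cast
      simp [(Fin.castSucc_lt_last i).ne]
      ring
  · simp only [hχ, if_false]
    rw [he χ hχ i]
    split_ifs <;> ring

/-- An LP-packing together with its subgroup is given by the fibres of a function to
`Option (Fin t)`; at every character exactly one fibre has an exceptional character sum. -/
theorem IsLPPacking.exists_index {c t : ℕ} (hc : 0 < c) (ht : 0 < t) {P : Fin t → Set H}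
    {U : Subgroup H} (h : IsLPPacking c t P U) :
    ∃ (β : H → Option (Fin t)) (e : (H →* ℂ) → Option (Fin t)),
      (∀ i, P i = {x | β x = some i}) ∧ (U : Set H) = {x | β x = none} ∧
      β 1 = none ∧ (∀ x, β x⁻¹ = β x) ∧ e 1 = none ∧
      (∀ χ : H →* ℂ, setCharSum χ {x | β x = none} =
        if e χ = none then (t * c : ℂ) else 0) ∧
      ∀ (χ : H →* ℂ) (i : Fin t), setCharSum χ {x | β x = some i} =
        -c + (if some i = e χ then (t * c : ℂ) else 0) +
          open Classical in if χ = 1 then (t * c ^ 2 : ℂ) else 0 := by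
  classical
  obtain ⟨hcard, hU, hP, hdisj, hunion⟩ := h
  have htc : 0 < t * c := Nat.mul_pos ht hc
  have hmemU : ∀ x, x ∈ U ↔ ∀ i, x ∉ P i := fun x => by
    have := Set.ext_iff.1 hunion x
    simp only [Set.mem_iUnion, Set.mem_sdiff, Set.mem_univ, true_and, SetLike.mem_coe] at this
    rw [← not_iff_not, ← this]
    simp
  have hex : ∀ x, ∃ o : Option (Fin t), (∀ i, x ∈ P i ↔ o = some i) ∧ (x ∈ U ↔ o = none) := by
    intro x
    by_cases hx : x ∈ U
    · exact ⟨none, fun i => by simp [(hmemU x).1 hx i], by simp [hx]⟩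
    · obtain ⟨i, hi⟩ : ∃ i, x ∈ P i := by simpa [hmemU] using hx
      refine ⟨some i, fun j => ⟨fun hj => ?_, fun hj => ?_⟩, by simp [hx]⟩
      · by_contra hij
        exact Set.disjoint_left.1 (hdisj i j fun h => hij (by rw [h])) hi hj
      · rwa [← Option.some_injective _ hj]
  choose β hβP hβU using hex
  have hfib : ∀ i, P i = {x | β x = some i} := fun i => Set.ext fun x => hβP x i
  have hfibU : (U : Set H) = {x | β x = none} := Set.ext fun x => hβU x
  have hinv : ∀ x, β x⁻¹ = β x := by
    intro x
    rcases ho : β x with _ | i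
    · rw [← hβU, inv_mem_iff, hβU, ho]
    · rw [← hβP, ← Set.mem_inv, (hP i).2.2, hβP, ho]
  have hval : ∀ χ : H →* ℂ, χ ≠ 1 → ∃ j, ∀ o : Option (Fin t),
      setCharSum χ {x | β x = o} - (if o = none then (c : ℂ) else 0) =
      -(c : ℂ) + if o = j then ((t : ℂ) * c) else 0 := by
    intro χ hχ
    refine exists_forall_eq_add_ite (by exact_mod_cast htc.ne') ?_ ?_
    · rintro (_ | i)
      · rw [← hfibU]
        rcases setCharSum_subgroup χ U with h | h
        · left
          simp [h]
        · right
          rw [h, hU]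
          push_cast
          simp
          ring
      · rw [← hfib]
        rcases (hP i).setCharSum_eq htc hχ with h | h
        · left
          simp [h]
        · right
          simp [h]
    · rw [Finset.sum_sub_distrib, sum_setCharSum_fiber, sum_hom_eq_ite, if_neg hχ]
      simp
      ring
  choose! e he using hval
  refine ⟨β, fun χ => if χ = 1 then none else e χ, hfib, hfibU, (hβU 1).1 U.one_mem, hinv,
    by simp, fun χ => ?_, fun χ i => ?_⟩
  · by_cases hχ : χ = 1
    · subst hχ
      rw [setCharSum_one, ← hfibU]
      simpa using congrArg (Nat.cast (R := ℂ)) hU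
    · have := he χ hχ none
      simp only [hχ, if_false, if_true, eq_comm (a := e χ)] at this ⊢
      linear_combination this
  · by_cases hχ : χ = 1
    · subst hχ
      rw [setCharSum_one, ← hfib, (hP i).1.2.1]
      push_cast [Nat.cast_sub (show 1 ≤ t * c from htc)]
      simp
      ring
    · have := he χ hχ (some i)
      simp only [hχ, if_false, reduceCtorEq] at this ⊢
      linear_combination this

/-- Criterion for the fibres of a function to `Fin t`, the last one excepted, to form an
NLP-packing. -/
theorem isNLPPacking_of_index {c t : ℕ} (hc : 0 < c) (hcard : Nat.card H = t ^ 2 * c ^ 2)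
    {last : Fin t} (hlast : (last : ℕ) = t - 1) (γ : H → Fin t) (e : (H →* ℂ) → Fin t)
    (h1 : γ 1 = last) (hinv : ∀ x, γ x⁻¹ = γ x) (he : e 1 = last)
    (hγ : ∀ (χ : H →* ℂ) (i : Fin t), setCharSum χ {x | γ x = i} =
        c - (if i = e χ then (t * c : ℂ) else 0) +
          open Classical in if χ = 1 then (t * c ^ 2 : ℂ) else 0) :
    IsNLPPacking c t fun l : Fin (t - 1) => {x | γ x = Fin.castLE (Nat.sub_le t 1) l} := by
  classical
  have hcard' : Nat.card H = (t * c) ^ 2 := by rw [hcard, mul_pow]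
  have hne : ∀ l : Fin (t - 1), Fin.castLE (Nat.sub_le t 1) l ≠ last := fun l h => by
    have h' := congrArg Fin.val h
    have := l.2
    simp only [Fin.val_castLE] at h'
    omega
  refine ⟨hcard, fun l => isNegLatinPDS_of_setCharSum hcard' ?_ ?_ ?_ fun χ hχ => ?_, ?_⟩
  · simpa [h1] using (hne l).symm
  · ext x
    simp [hinv]
  · rw [hγ, he]
    simp only [hne l, if_true, if_false]
    push_cast
    ring
  · rw [hγ]
    simp only [hχ, if_false]
    split_ifs
    · right
      push_cast
      ring
    · left
      ring
  · set D : Set H := Set.univ \ ({1} ∪ ⋃ l : Fin (t - 1),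
      {x | γ x = Fin.castLE (Nat.sub_le t 1) l}) with hD
    have h1D : (1 : H) ∉ D := by simp [hD]
    have hmem : ∀ x, x ∈ D ↔ x ≠ 1 ∧ γ x = last := by
      intro x
      simp only [hD, Set.mem_sdiff, Set.mem_univ, true_and, Set.mem_union, Set.mem_singleton_iff,
        Set.mem_iUnion, Set.mem_ofPred_eq, not_or, not_exists]
      refine and_congr_right fun _ => ⟨fun h => ?_, fun h l => by rw [h]; exact (hne l).symm⟩
      by_contra hx
      have hlt : (γ x : ℕ) < t - 1 := by
        have := (γ x).2
        have h' : (γ x : ℕ) ≠ last := fun h' => hx (Fin.ext h')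
        omega
      exact h ⟨γ x, hlt⟩ rfl
    have hins : insert 1 D = {x | γ x = last} := by
      ext x
      by_cases hx : x = 1
      · simp [hx, h1]
      · simp [hx, hmem]
    have hS : ∀ χ, setCharSum χ D = setCharSum χ {x | γ x = last} - 1 := fun χ => by
      rw [← hins, setCharSum_insert_one h1D]
      ring
    refine isNegLatinPDS_of_setCharSum hcard' h1D ?_ ?_ fun χ hχ => ?_
    · ext x
      simp [hmem, hinv]
    · rw [hS, hγ, he]
      push_cast [Nat.cast_sub (show 1 ≤ c from hc)]
      simp
      ring
    · rw [hS, hγ]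
      push_cast [Nat.cast_sub (show 1 ≤ c from hc)]
      simp only [hχ, if_false]
      split_ifs
      · right
        ring
      · left
        ring

end Packings

/-- The index of the fibre of the product packing from the indices of the two coordinates. -/
def productIndex {t : ℕ} [NeZero t] (i : Fin t) : Option (Fin t) → Fin t
  | none => i
  | some j => j - i

theorem stmt_17 {G1 G2 : Type*} [CommGroup G1] [Finite G1] [CommGroup G2] [Finite G2]
    (c1 c2 t : ℕ) (ht : 1 < t) (U2 : Subgroup G2)
    (P1 : Fin (t - 1) → Set G1) (P2 : Fin t → Set G2)
    (h1 : IsNLPPacking c1 t P1) (h2 : IsLPPacking c2 t P2 U2) :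
    IsNLPPacking (t * c1 * c2) t
      (fun l : Fin (t - 1) =>
        (P1 l ×ˢ (U2 : Set G2)) ∪
          ⋃ i : Fin t,
            (if h : (i : ℕ) < t - 1 then P1 ⟨(i : ℕ), h⟩ else Set.univ \ ⋃ j, P1 j) ×ˢ
              P2 (i + Fin.castLE (Nat.sub_le t 1) l)) := by
  classical
  cases nonempty_fintype G1
  cases nonempty_fintype G2
  have : NeZero t := ⟨by omega⟩
  have hc1 : 0 < c1 := by
    rcases Nat.eq_zero_or_pos c1 with h | h
    · have := h1.1
      simp [h] at this
    · exact h
  have hc2 : 0 < c2 := by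
    rcases Nat.eq_zero_or_pos c2 with h | h
    · have := h2.1
      simp [h] at this
    · exact h
  have hcard : Nat.card (G1 × G2) = t ^ 2 * (t * c1 * c2) ^ 2 := by
    rw [Nat.card_prod, h1.1, h2.1]
    ring
  let last : Fin t := ⟨t - 1, by omega⟩
  obtain ⟨α, a, hα, hα1, hαinv, ha, hSα⟩ := h1.exists_index hc1 (last := last) rfl
  obtain ⟨β, b, hβ, hβU, hβ1, hβinv, hb, hSU, hSβ⟩ := h2.exists_index hc2 (by omega)
  have hP1 : ∀ l : Fin (t - 1), P1 l = {x | α x = Fin.castLE (Nat.sub_le t 1) l} := by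
    intro l
    rw [← hα, dif_pos (by simp)]
    rfl
  have hset : (fun l : Fin (t - 1) => (P1 l ×ˢ (U2 : Set G2)) ∪
      ⋃ i : Fin t,
        (if h : (i : ℕ) < t - 1 then P1 ⟨(i : ℕ), h⟩ else Set.univ \ ⋃ j, P1 j) ×ˢ
          P2 (i + Fin.castLE (Nat.sub_le t 1) l)) =
      fun l : Fin (t - 1) => {p : G1 × G2 |
        productIndex (α p.1) (β p.2) = Fin.castLE (Nat.sub_le t 1) l} := by
    funext l
    simp only [hα, hβ, hβU]
    rw [hP1]
    ext ⟨x, y⟩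
    rcases ho : β y with _ | j
    · simp [ho, productIndex]
    · simp [ho, productIndex, sub_eq_iff_eq_add']
  rw [hset]
  refine isNLPPacking_of_index (by positivity) hcard (last := last) rfl
    (fun p => productIndex (α p.1) (β p.2))
    (fun χ => productIndex (a (χ.comp (MonoidHom.inl G1 G2))) (b (χ.comp (MonoidHom.inr G1 G2))))
    ?_ ?_ ?_ fun χ l => ?_
  · simp [hα1, hβ1, productIndex]
  · rintro ⟨x, y⟩
    simp [hαinv, hβinv]
  · simp [ha, hb, productIndex]
  · set χ₁ := χ.comp (MonoidHom.inl G1 G2) with hχ₁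
    set χ₂ := χ.comp (MonoidHom.inr G1 G2) with hχ₂
    have hmul : ∀ p : G1 × G2, χ p = χ₁ p.1 * χ₂ p.2 := fun p => by
      simp [hχ₁, hχ₂, ← map_mul]
    have hone : χ = 1 ↔ χ₁ = 1 ∧ χ₂ = 1 := by
      constructor
      · intro h
        simp [hχ₁, hχ₂, h]
      · rintro ⟨h, h'⟩
        ext p
        simp [hmul, h, h']
    have hsum : setCharSum χ {p : G1 × G2 | productIndex (α p.1) (β p.2) = l} =
        ∑ i, ((if i = l then setCharSum χ₂ {y | β y = none} else 0) +
          setCharSum χ₂ {y | β y = some (l + i)}) * setCharSum χ₁ {x | α x = i} := by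
      have hinner : ∀ i, (if i = l then setCharSum χ₂ {y | β y = none} else 0) +
          setCharSum χ₂ {y | β y = some (l + i)} =
          ∑ y, (if productIndex i (β y) = l then 1 else 0) * χ₂ y := by
        intro i
        rw [sum_comp_mul_eq_sum_setCharSum β (fun o => if productIndex i o = l then (1 : ℂ) else 0),
          Fintype.sum_option]
        by_cases h : i = l <;> simp [productIndex, sub_eq_iff_eq_add, h]
      rw [← sum_comp_mul_eq_sum_setCharSum α (fun i =>
        (if i = l then setCharSum χ₂ {y | β y = none} else 0) +
          setCharSum χ₂ {y | β y = some (l + i)}), setCharSum, Fintype.sum_prod_type]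
      refine Finset.sum_congr rfl fun x _ => ?_
      rw [hinner, Finset.sum_mul]
      refine Finset.sum_congr rfl fun y _ => ?_
      by_cases h : productIndex (α x) (β y) = l
      · simp [h, hmul, mul_comm]
      · simp [h]
    rw [hsum, hSU]
    simp only [hSα, hSβ]
    rcases hbo : b χ₂ with _ | j
    · generalize a χ₁ = k
      simp only [productIndex, add_mul, mul_add, mul_sub, Finset.sum_add_distrib,
        Finset.sum_sub_distrib, hone, ite_and]
      by_cases hχ₁1 : χ₁ = 1 <;> by_cases hχ₂1 : χ₂ = 1 <;> by_cases hl : l = k <;>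
        simp [hχ₁1, hχ₂1, hl, eq_comm (a := k)] <;> ring
    · have hχ₂1 : χ₂ ≠ 1 := fun h => by simp [h, hb] at hbo
      generalize a χ₁ = k
      have hadd : ∀ i, l + i = j ↔ i = j - l := fun i => by rw [eq_sub_iff_add_eq']
      have hswap : l = j - k ↔ j - l = k := by
        rw [eq_sub_iff_add_eq, sub_eq_iff_eq_add', eq_comm]
      simp only [productIndex, add_mul, mul_add, mul_sub, Finset.sum_add_distrib,
        Finset.sum_sub_distrib, hone, hχ₂1, hadd, hswap, Option.some.injEq]
      by_cases hχ₁1 : χ₁ = 1 <;> by_cases hl : j - l = k <;>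
        simp [hχ₁1, hl, eq_comm (a := k)] <;> ring
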